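/- The value of the rank of M_k = (1-ω)A_k + (1-ω̄)A_kᵀ at ω = e^{iπ/3} is independent of k: for all integers k, j ≥ 2, rank(M_k) = rank(M_j) = 5. -/

import Mathlib

open Matrix Complex

def A (k : ℤ) : Matrix (Fin 6) (Fin 6) ℤ :=
  !![-1,-1,0,0,-1,0; 0,-1,0,0,-1,0; 0,0,1,1,1,0; 0,0,0,1,1,0; 0,0,0,0,0,0; 0,0,0,0,1,-k]

noncomputable def ω : ℂ := Complex.exp (Real.pi / 3 * Complex.I)

noncomputable def M (k : ℤ) : Matrix (Fin 6) (Fin 6) ℂ :=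
  (1 - ω) • (A k).map (fun x => (x : ℂ)) +
    (1 - (starRingEnd ℂ) ω) • ((A k).map (fun x => (x : ℂ)))ᵀ

lemma omega_eq : ω = ((1 / 2 : ℝ) : ℂ) + ((√3 / 2 : ℝ) : ℂ) * Complex.I := by
  have h : (Real.pi / 3 * Complex.I : ℂ) = ((Real.pi / 3 : ℝ) : ℂ) * Complex.I := by
    push_cast; ring
  rw [ω, h, Complex.exp_mul_I, ← Complex.ofReal_cos, ← Complex.ofReal_sin,
    Real.cos_pi_div_three, Real.sin_pi_div_three]

lemma omega_conj : (starRingEnd ℂ) ω = 1 - ω := by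
  rw [omega_eq]
  rw [map_add, map_mul, Complex.conj_ofReal, Complex.conj_ofReal, Complex.conj_I]
  push_cast
  ring

lemma omega_sq : ω * ω = ω - 1 := by
  rw [omega_eq]
  have h : √3 * √3 = 3 := Real.mul_self_sqrt (by norm_num)
  apply Complex.ext <;> simp <;> nlinarith

lemma M_eq (k : ℤ) : M k =
    !![-1, -(1 - ω), 0, 0, -(1 - ω), 0;
       -ω, -1, 0, 0, -(1 - ω), 0;
       0, 0, 1, 1 - ω, 1 - ω, 0;
       0, 0, ω, 1, 1 - ω, 0;
       -ω, -ω, ω, ω, 0, ω;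
       0, 0, 0, 0, 1 - ω, -(k : ℂ)] := by
  rw [M, omega_conj]
  ext i j
  fin_cases i <;> fin_cases j <;> simp [A] <;> ring

lemma rank_M (k : ℤ) (hk : 2 ≤ k) : (M k).rank = 5 := by
  have hw := omega_sq
  have hk0 : (k : ℂ) ≠ 0 := by exact_mod_cast (by omega : k ≠ 0)
  apply le_antisymm
  · -- the row relation r₁ - ω r₀ + r₃ - ω r₂ = 0 shows that the determinant vanishes
    let v : Matrix (Fin 1) (Fin 6) ℂ := !![-ω, 1, -ω, 1, 0, 0]
    have hv : v * M k = 0 := by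
      rw [M_eq]
      ext i j
      fin_cases i; fin_cases j <;>
        simp [v, Matrix.mul_apply, Fin.sum_univ_succ] <;> grind
    have h1 := Matrix.rank_add_rank_le_card_of_mul_eq_zero hv
    have h2 := Matrix.rank_submatrix_le v (fun _ : Fin 1 => 0) (fun _ : Fin 1 => 1)
    have h3 : v.submatrix (fun _ : Fin 1 => 0) (fun _ : Fin 1 => 1) = 1 := by
      ext i j
      fin_cases i; fin_cases j; simp [v]
    rw [h3, Matrix.rank_one] at h2
    simp at h1 h2
    omega
  · have h := Matrix.rank_submatrix_le (M k) ![0, 1, 2, 4, 5] ![0, 1, 2, 4, 5]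
    have hs : (M k).submatrix ![0, 1, 2, 4, 5] ![0, 1, 2, 4, 5] =
        !![-1, -(1 - ω), 0, -(1 - ω), 0;
           -ω, -1, 0, -(1 - ω), 0;
           0, 0, 1, 1 - ω, 0;
           -ω, -ω, ω, 0, ω;
           0, 0, 0, 1 - ω, -(k : ℂ)] := by
      rw [M_eq]
      ext i j
      fin_cases i <;> fin_cases j <;> rfl
    have hd : ((M k).submatrix ![0, 1, 2, 4, 5] ![0, 1, 2, 4, 5]).det ≠ 0 := by
      rw [hs]
      simp [Matrix.det_succ_row_zero, Fin.sum_univ_succ, Fin.succAbove]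
      grind
    rw [Matrix.rank_of_det_ne_zero hd] at h
    simpa using h

theorem stmt_18 (k j : ℤ) (hk : 2 ≤ k) (hj : 2 ≤ j) :
    (M k).rank = (M j).rank ∧ (M k).rank = 5 := by
  rw [rank_M k hk, rank_M j hj]
  exact ⟨rfl, rfl⟩
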